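/- arXiv:2605.30844 — 2 statements merged into one kernel-verified Lean document; each statement's English description precedes it below -/
import Mathlib

section
/- Let X be a prompt random variable and let (Z_t)_{t≥1} be a generation process on a finite alphabet Z = V ∪ {EOS} in which EOS is absorbing (Z_t = EOS implies Z_s = EOS for all s > t), with almost surely finite stopping time N := inf{t ≥ 1 : Z_t = EOS}, and let Y_t := Z_t for t < N. Then the Canopy Entropy equals the joint conditional Shannon entropy of length and content: CE* := E[Σ_{t=1}^{N} H̃(G_t | X)] = H(N, Y_{1:N} | X), where H̃(g_t | x) := H(Z_t | G_t = g_t, X = x) is the Shannon entropy of the next-step conditional distribution given the realized history g_t = (z_1, …, z_{t−1}) and prompt x, and the expectation is over the prompt and the random history. -/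
open scoped BigOperators ENNReal

/-- `prefixProb q x hist g` is the probability, under the autoregressive next-step
distributions `q x · ·` (over `Option V`, with `none` playing the role of `EOS`),
of generating the tokens of `g` one after another starting from the history `hist`
(without stopping).  `prefixProb q x [] g` is thus the probability that the history at
step `|g| + 1` equals `g` and generation has not yet terminated, i.e. `P(G_t = g, t ≤ N)`
for `t = |g| + 1`. -/
noncomputable def prefixProb {X V : Type*} (q : X → List V → Option V → ℝ) (x : X) :
    List V → List V → ℝ
  | _hist, [] => 1
  | hist, v :: rest => q x hist (some v) * prefixProb q x (hist ++ [v]) rest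

/-- `localEnt q x g = H̃(g | x)`: the Shannon entropy of the next-step conditional
distribution `q x g` over `Z = V ∪ {EOS}` at the realized history `g` and prompt `x`. -/
noncomputable def localEnt {X V : Type*} [Fintype V] (q : X → List V → Option V → ℝ)
    (x : X) (g : List V) : ℝ :=
  ∑ z : Option V, Real.negMulLog (q x g z)

theorem ce_tsum_list {V : Type*} [Fintype V] (f : List V → ℝ≥0∞) :
    ∑' y, f y = f [] + ∑ v, ∑' r, f (v :: r) := by
  let e : Option (V × List V) ≃ List V :=
    { toFun := fun o => match o with
        | none => []
        | some p => p.1 :: p.2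
      invFun := fun l => match l with
        | [] => none
        | v :: r => some (v, r)
      left_inv := by rintro (_ | ⟨v, r⟩) <;> rfl
      right_inv := by rintro (_ | ⟨v, r⟩) <;> rfl }
  rw [← e.tsum_eq, ← tsum_fintype (L := .unconditional _), ← ENNReal.tsum_prod (f := fun v r => f (v :: r))]
  rw [← (Equiv.optionEquivSumPUnit.{0} (V × List V)).symm.tsum_eq]
  rw [Summable.tsum_sum ENNReal.summable ENNReal.summable, add_comm]
  simp [e]

section
variable {X V : Type*} [Fintype V] (q : X → List V → Option V → ℝ) (x : X)

noncomputable def ceRoll (h y : List V) : ℝ := prefixProb q x h y * q x (h ++ y) none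

noncomputable def ceCost : ℕ → List V → List V → ℝ≥0∞
  | 0, h, [] => ENNReal.ofReal (-Real.log (q x h none))
  | 0, h, v :: _ => ENNReal.ofReal (-Real.log (q x h (some v)))
  | _ + 1, _, [] => 0
  | n + 1, h, v :: r => ceCost n (h ++ [v]) r

theorem ce_le_one (hq0 : ∀ x g z, 0 ≤ q x g z) (hq1 : ∀ x g, ∑ z : Option V, q x g z = 1)
    (g : List V) (z : Option V) : q x g z ≤ 1 := by
  rw [← hq1 x g]
  exact Finset.single_le_sum (f := fun z => q x g z) (fun i _ => hq0 x g i) (Finset.mem_univ z)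

theorem ce_prefix (hq0 : ∀ x g z, 0 ≤ q x g z) (hq1 : ∀ x g, ∑ z : Option V, q x g z = 1)
    (h y : List V) : 0 ≤ prefixProb q x h y ∧ prefixProb q x h y ≤ 1 := by
  induction y generalizing h with
  | nil => simp [prefixProb]
  | cons v r ih =>
    simp only [prefixProb]
    exact ⟨mul_nonneg (hq0 _ _ _) (ih _).1,
      mul_le_one₀ (ce_le_one q x hq0 hq1 _ _) (ih _).1 (ih _).2⟩

theorem ceRoll_nil (h : List V) : ceRoll q x h [] = q x h none := by
  simp [ceRoll, prefixProb]

theorem ceRoll_cons (h : List V) (v : V) (r : List V) :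
    ceRoll q x h (v :: r) = q x h (some v) * ceRoll q x (h ++ [v]) r := by
  simp [ceRoll, prefixProb, mul_assoc]

theorem ceRoll_bd (hq0 : ∀ x g z, 0 ≤ q x g z) (hq1 : ∀ x g, ∑ z : Option V, q x g z = 1)
    (h y : List V) : 0 ≤ ceRoll q x h y ∧ ceRoll q x h y ≤ 1 := by
  have := ce_prefix q x hq0 hq1 h y
  exact ⟨mul_nonneg this.1 (hq0 _ _ _),
    mul_le_one₀ this.2 (hq0 _ _ _) (ce_le_one q x hq0 hq1 _ _)⟩

theorem ce_sumQ (hq0 : ∀ x g z, 0 ≤ q x g z) (hq1 : ∀ x g, ∑ z : Option V, q x g z = 1)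
    (h : List V) :
    ENNReal.ofReal (q x h none) + ∑ v, ENNReal.ofReal (q x h (some v)) = 1 := by
  rw [← Fintype.sum_option (f := fun z => ENNReal.ofReal (q x h z)),
    ← ENNReal.ofReal_sum_of_nonneg (fun i _ => hq0 x h i), hq1]
  simp

theorem ce_mul_log (hq0 : ∀ x g z, 0 ≤ q x g z) (h : List V) (z : Option V) :
    ENNReal.ofReal (q x h z) * ENNReal.ofReal (-Real.log (q x h z))
      = ENNReal.ofReal (Real.negMulLog (q x h z)) := by
  rw [← ENNReal.ofReal_mul (hq0 _ _ _)]
  simp [Real.negMulLog]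

theorem ce_negMulLog (hq0 : ∀ x g z, 0 ≤ q x g z) (hq1 : ∀ x g, ∑ z : Option V, q x g z = 1)
    (h y : List V) :
    ENNReal.ofReal (Real.negMulLog (ceRoll q x h y))
      = ENNReal.ofReal (ceRoll q x h y) * ∑' n, ceCost q x n h y := by
  induction y generalizing h with
  | nil =>
    rw [tsum_eq_zero_add' ENNReal.summable]
    simp [ceRoll_nil, ceCost, ce_mul_log q x hq0]
  | cons v r ih =>
    have hb := ceRoll_bd q x hq0 hq1 (h ++ [v]) r
    have hv := hq0 x h (some v)
    have hv1 := ce_le_one q x hq0 hq1 h (some v)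
    rw [tsum_eq_zero_add' ENNReal.summable, ceRoll_cons, Real.negMulLog_mul,
      ENNReal.ofReal_add (mul_nonneg hb.1 (Real.negMulLog_nonneg hv hv1))
        (mul_nonneg hv (Real.negMulLog_nonneg hb.1 hb.2)),
      ENNReal.ofReal_mul hb.1, ENNReal.ofReal_mul hv, ENNReal.ofReal_mul hv, ih,
      ← ce_mul_log q x hq0]
    simp only [ceCost]
    ring

noncomputable def ceMass (h : List V) : ℝ≥0∞ := ∑' y, ENNReal.ofReal (ceRoll q x h y)

theorem ceMass_eq (hq0 : ∀ x g z, 0 ≤ q x g z) (h : List V) :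
    ceMass q x h = ENNReal.ofReal (q x h none)
      + ∑ v, ENNReal.ofReal (q x h (some v)) * ceMass q x (h ++ [v]) := by
  unfold ceMass
  rw [ce_tsum_list]
  simp only [ceRoll_nil, ceRoll_cons, ENNReal.ofReal_mul (hq0 _ _ _), ENNReal.tsum_mul_left]

theorem ce_trunc (hq0 : ∀ x g z, 0 ≤ q x g z) (hq1 : ∀ x g, ∑ z : Option V, q x g z = 1)
    (n : ℕ) (h : List V) :
    ∑' y : List V, (if y.length < n then ENNReal.ofReal (ceRoll q x h y) else 0) ≤ 1 := by
  induction n generalizing h with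
  | zero => simp
  | succ n ih =>
    rw [ce_tsum_list, ← ce_sumQ q x hq0 hq1 h]
    simp only [List.length_nil, Nat.zero_lt_succ, if_true, ceRoll_nil]
    gcongr with v
    simp only [List.length_cons, Nat.succ_lt_succ_iff, ceRoll_cons,
      ENNReal.ofReal_mul (hq0 _ _ _), ← mul_ite_zero, ENNReal.tsum_mul_left]
    exact mul_le_of_le_one_right' (ih _)

theorem ceMass_le (hq0 : ∀ x g z, 0 ≤ q x g z) (hq1 : ∀ x g, ∑ z : Option V, q x g z = 1)
    (h : List V) : ceMass q x h ≤ 1 := by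
  unfold ceMass
  rw [ENNReal.tsum_eq_iSup_sum]
  refine iSup_le fun s => ?_
  refine le_trans ?_ (ce_trunc q x hq0 hq1 (s.sup List.length + 1) h)
  refine le_trans (Finset.sum_le_sum fun y hy => ?_) (ENNReal.sum_le_tsum s)
  rw [if_pos (Nat.lt_succ_of_le (Finset.le_sup (f := List.length) hy))]

theorem ceMass_child (hq0 : ∀ x g z, 0 ≤ q x g z) (hq1 : ∀ x g, ∑ z : Option V, q x g z = 1)
    (h : List V) (hm : ceMass q x h = 1) (v : V) :
    ENNReal.ofReal (q x h (some v)) = 0 ∨ ceMass q x (h ++ [v]) = 1 := by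
  by_contra! hc
  have hlt := lt_of_le_of_ne (ceMass_le q x hq0 hq1 (h ++ [v])) hc.2
  have h1 : ∑ v, ENNReal.ofReal (q x h (some v)) * ceMass q x (h ++ [v])
      < ∑ v, ENNReal.ofReal (q x h (some v)) := by
    rw [← tsum_fintype (L := .unconditional _), ← tsum_fintype (L := .unconditional _)]
    have hle : ∀ v, ENNReal.ofReal (q x h (some v)) * ceMass q x (h ++ [v])
        ≤ ENNReal.ofReal (q x h (some v)) := fun v =>
      mul_le_of_le_one_right' (ceMass_le q x hq0 hq1 (h ++ [v]))
    refine ENNReal.tsum_lt_tsum (i := v) ?_ hle ?_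
    · rw [tsum_fintype]
      exact ((ENNReal.sum_lt_top.2 fun v _ => lt_of_le_of_lt (hle v) ENNReal.ofReal_lt_top)).ne
    · simpa using ENNReal.mul_lt_mul_right hc.1 ENNReal.ofReal_ne_top hlt
  have h2 := ENNReal.add_lt_add_left (ENNReal.ofReal_ne_top (r := q x h none)) h1
  rw [← ceMass_eq q x hq0, ce_sumQ q x hq0 hq1, hm] at h2
  exact lt_irrefl _ h2

theorem ce_step (hq0 : ∀ x g z, 0 ≤ q x g z) (hq1 : ∀ x g, ∑ z : Option V, q x g z = 1)
    (n : ℕ) (h : List V) (hm : ceMass q x h = 1) :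
    ∑' y, ENNReal.ofReal (ceRoll q x h y) * ceCost q x n h y
      = ∑' g : List V, if n = g.length then
          ENNReal.ofReal (prefixProb q x h g * localEnt q x (h ++ g)) else 0 := by
  induction n generalizing h with
  | zero =>
    rw [ce_tsum_list, ce_tsum_list]
    simp only [ceCost, ceRoll_nil, ceRoll_cons, ENNReal.ofReal_mul (hq0 _ _ _),
      ENNReal.tsum_mul_right, ENNReal.tsum_mul_left, ce_mul_log q x hq0]
    have : ∀ v, ENNReal.ofReal (q x h (some v))
        * (∑' r, ENNReal.ofReal (ceRoll q x (h ++ [v]) r))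
        = ENNReal.ofReal (q x h (some v)) := by
      intro v
      rcases ceMass_child q x hq0 hq1 h hm v with h0 | h0
      · simp [h0]
      · unfold ceMass at h0
        simp [h0]
    simp only [this, ce_mul_log q x hq0]
    rw [← Fintype.sum_option (f := fun z => ENNReal.ofReal (Real.negMulLog (q x h z))),
      ← ENNReal.ofReal_sum_of_nonneg
        (fun z _ => Real.negMulLog_nonneg (hq0 x h z) (ce_le_one q x hq0 hq1 h z))]
    simp [prefixProb, localEnt]
  | succ n ih =>
    rw [ce_tsum_list, ce_tsum_list]
    simp only [ceCost, ceRoll_cons, ENNReal.ofReal_mul (hq0 _ _ _), prefixProb, mul_assoc,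
      ENNReal.tsum_mul_left, List.length_cons, List.length_nil, Nat.add_right_cancel_iff,
      ← mul_ite_zero, mul_zero, Nat.succ_ne_zero, if_false]
    congr 1
    refine Finset.sum_congr rfl fun v _ => ?_
    rcases ceMass_child q x hq0 hq1 h hm v with h0 | h0
    · simp [h0]
    · rw [ih _ h0]
      simp

theorem ce_main (hq0 : ∀ x g z, 0 ≤ q x g z) (hq1 : ∀ x g, ∑ z : Option V, q x g z = 1)
    (h : List V) (hm : ceMass q x h = 1) :
    ∑' g : List V, ENNReal.ofReal (prefixProb q x h g * localEnt q x (h ++ g))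
      = ∑' y, ENNReal.ofReal (Real.negMulLog (ceRoll q x h y)) := by
  simp only [ce_negMulLog q x hq0 hq1, ← ENNReal.tsum_mul_left]
  rw [ENNReal.tsum_comm]
  simp only [ce_step q x hq0 hq1 _ h hm]
  rw [ENNReal.tsum_comm]
  simp only [tsum_ite_eq]

end

/-- **Canopy Entropy equals total entropy.**
The prompt `X` is drawn from the probability mass function `pX` on the finite prompt
space `X`, and conditionally on `X = x` the generation process on the finite alphabet
`Z = V ∪ {EOS}` (here `Option V`, with `none` as the absorbing symbol `EOS`) evolves by
sampling the next symbol from `q x g` at history `g`.  The stopping time is a.s. finite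
(`hfinite`: the completed-rollout probabilities `P(Y_{1:N} = y | X = x)
= prefixProb q x [] y * q x y none` sum to one).  A completed rollout `y : List V`
encodes exactly the pair `(N, Y_{1:N})` (since `N = |y| + 1`).  Then the Canopy Entropy
`CE* = E[Σ_{t=1}^{N} H̃(G_t | X)]` — the expected cumulative local entropy along a
rollout, i.e. `Σ_x pX x Σ_g P(G = g, generation still active) H̃(g | x)` — equals the
joint conditional Shannon entropy of length and content
`H(N, Y_{1:N} | X) = Σ_x pX x Σ_y negMulLog (P(N, Y_{1:N} = y | X = x))`.
(Both sides are computed in `ℝ≥0∞`, term-by-term via `ENNReal.ofReal` of the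
nonnegative summands, so that no summability assumptions are needed, per Tonelli.) -/
theorem canopy_entropy_eq_joint_entropy
    {X V : Type*} [Fintype X] [Fintype V]
    (pX : X → ℝ) (hpX0 : ∀ x, 0 ≤ pX x) (hpX1 : ∑ x : X, pX x = 1)
    (q : X → List V → Option V → ℝ)
    (hq0 : ∀ x g z, 0 ≤ q x g z)
    (hq1 : ∀ x g, ∑ z : Option V, q x g z = 1)
    (hfinite : ∀ x,
      ∑' y : List V, ENNReal.ofReal (prefixProb q x [] y * q x y none) = 1) :
    ∑ x : X, ENNReal.ofReal (pX x)
        * ∑' g : List V, ENNReal.ofReal (prefixProb q x [] g * localEnt q x g)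
      = ∑ x : X, ENNReal.ofReal (pX x)
        * ∑' y : List V,
            ENNReal.ofReal (Real.negMulLog (prefixProb q x [] y * q x y none)) := by
  refine Finset.sum_congr rfl fun x _ => ?_
  have := ce_main q x hq0 hq1 [] (by simpa [ceMass, ceRoll] using hfinite x)
  simp only [ceRoll, List.nil_append] at this
  rw [this]
end

section
/- Under hierarchical Monte Carlo sampling with 0 ≤ S_max ≤ H_max N_max almost surely, the estimator ĈE*_{max,P,M} := (PM)^{−1} Σ_{p,i} S_max^{(p,i)} is unbiased for CE*_max := E[S_max], and for every δ ∈ (0,1), with probability at least 1 − δ, |ĈE*_{max,P,M} − CE*_max| ≤ H_max ν_max √((1/δ)(1/P + 1/(PM))); consequently, if g(T_max) := CE* − CE*_max ≥ 0 denotes the truncation bias, then with probability at least 1 − δ, |ĈE*_{max,P,M} − CE*| ≤ H_max ν_max √((1/δ)(1/P + 1/(PM))) + g(T_max). -/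
open scoped BigOperators
open MeasureTheory

open ProbabilityTheory in
lemma aux_mp_comm {A B C D : Type*} [MeasurableSpace A] [MeasurableSpace B] [MeasurableSpace C]
    [MeasurableSpace D] (a : Measure A) (b : Measure B) (c : Measure C) (d : Measure D)
    [IsProbabilityMeasure a] [IsProbabilityMeasure b] [IsProbabilityMeasure c]
    [IsProbabilityMeasure d] :
    MeasurePreserving (fun z : (A × B) × (C × D) => ((z.1.1, z.2.1), (z.1.2, z.2.2)))
      ((a.prod b).prod (c.prod d)) ((a.prod c).prod (b.prod d)) := by
  have h1 := measurePreserving_prodAssoc a b (c.prod d)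
  have h2 := (MeasurePreserving.id a).prod ((measurePreserving_prodAssoc b c d).symm)
  have h3 := (MeasurePreserving.id a).prod
    ((Measure.measurePreserving_swap (μ := b) (ν := c)).prod (MeasurePreserving.id d))
  have h4 := (MeasurePreserving.id a).prod (measurePreserving_prodAssoc c b d)
  have h5 := (measurePreserving_prodAssoc a c (b.prod d)).symm
  exact h5.comp (h4.comp (h3.comp (h2.comp h1)))

open ProbabilityTheory in
lemma aux_mp_pair {ι A : Type*} [Fintype ι] [MeasurableSpace A] (a : Measure A)
    [IsProbabilityMeasure a] {i j : ι} (hij : i ≠ j) :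
    MeasurePreserving (fun x : ι → A => (x i, x j)) (Measure.pi fun _ => a) (a.prod a) := by
  have h : iIndepFun (fun (i : ι) (x : ι → A) => x i) (Measure.pi fun _ => a) :=
    iIndepFun_pi (X := fun _ => id) (fun _ => aemeasurable_id)
  have h2 := (indepFun_iff_map_prod_eq_prod_map_map (measurable_pi_apply i).aemeasurable
    (measurable_pi_apply j).aemeasurable).1 (h.indepFun hij)
  have e : ∀ i : ι, Measure.map (fun x : ι → A => x i) (Measure.pi fun _ => a) = a :=
    fun i => (measurePreserving_eval (fun _ : ι => a) i).map_eq
  refine ⟨by fun_prop, ?_⟩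
  rw [h2, e, e]

open ProbabilityTheory in
lemma aux_mp_one {ι κ A B : Type*} [Fintype ι] [Fintype κ] [MeasurableSpace A] [MeasurableSpace B]
    (a : Measure A) (b : Measure B) [IsProbabilityMeasure a] [IsProbabilityMeasure b]
    (p : ι) (k : κ) :
    MeasurePreserving (fun w : (ι → A) × (κ → B) => (w.1 p, w.2 k))
      ((Measure.pi fun _ => a).prod (Measure.pi fun _ => b)) (a.prod b) :=
  (measurePreserving_eval (fun _ : ι => a) p).prod (measurePreserving_eval (fun _ : κ => b) k)

open ProbabilityTheory in
lemma aux_indep {ι κ A B : Type*} [Fintype ι] [Fintype κ] [MeasurableSpace A] [MeasurableSpace B]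
    (a : Measure A) (b : Measure B) [IsProbabilityMeasure a] [IsProbabilityMeasure b]
    {p q : ι} {k l : κ} (hpq : p ≠ q) (hkl : k ≠ l) :
    IndepFun (fun w : (ι → A) × (κ → B) => (w.1 p, w.2 k)) (fun w => (w.1 q, w.2 l))
      ((Measure.pi fun _ => a).prod (Measure.pi fun _ => b)) := by
  rw [indepFun_iff_map_prod_eq_prod_map_map (by fun_prop) (by fun_prop),
    (aux_mp_one a b p k).map_eq, (aux_mp_one a b q l).map_eq]
  exact ((aux_mp_comm a a b b).comp ((aux_mp_pair a hpq).prod (aux_mp_pair b hkl))).map_eq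

open ProbabilityTheory in
lemma aux_cov_le {Ω : Type*} [MeasurableSpace Ω] (μ : Measure Ω) [IsProbabilityMeasure μ]
    {X Y : Ω → ℝ} (hX : MemLp X 2 μ) (hY : MemLp Y 2 μ) {v : ℝ} (h1 : Var[X; μ] ≤ v)
    (h2 : Var[Y; μ] ≤ v) : cov[X, Y; μ] ≤ v := by
  have h := variance_nonneg (X - Y) μ
  rw [variance_sub hX hY] at h
  linarith

open ProbabilityTheory in
lemma aux_main {ΩX ΩU : Type*} [MeasurableSpace ΩX] [MeasurableSpace ΩU]
    (μX : Measure ΩX) (μU : Measure ΩU) [IsProbabilityMeasure μX] [IsProbabilityMeasure μU]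
    (S : ΩX × ΩU → ℝ) (hS : Measurable S) (hL : MemLp S 2 (μX.prod μU))
    (P M : ℕ) (hP : 1 ≤ P) (hM : 1 ≤ M) :
    MemLp (fun ω : (Fin P → ΩX) × (Fin P × Fin M → ΩU) =>
      (1 / ((P : ℝ) * M)) * ∑ p : Fin P, ∑ i : Fin M, S (ω.1 p, ω.2 (p, i))) 2
      ((Measure.pi fun _ : Fin P => μX).prod (Measure.pi fun _ : Fin P × Fin M => μU))
    ∧ (∫ ω, ((1 / ((P : ℝ) * M)) * ∑ p : Fin P, ∑ i : Fin M, S (ω.1 p, ω.2 (p, i)))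
        ∂((Measure.pi fun _ : Fin P => μX).prod (Measure.pi fun _ : Fin P × Fin M => μU))
      = ∫ ω, S ω ∂(μX.prod μU))
    ∧ Var[fun ω : (Fin P → ΩX) × (Fin P × Fin M → ΩU) =>
      (1 / ((P : ℝ) * M)) * ∑ p : Fin P, ∑ i : Fin M, S (ω.1 p, ω.2 (p, i));
      ((Measure.pi fun _ : Fin P => μX).prod (Measure.pi fun _ : Fin P × Fin M => μU))]
      ≤ (∫ ω, S ω ^ 2 ∂(μX.prod μU)) / P := by
  have hP' : (0 : ℝ) < P := by exact_mod_cast hP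
  have hM' : (0 : ℝ) < M := by exact_mod_cast hM
  set Pr := (Measure.pi fun _ : Fin P => μX).prod (Measure.pi fun _ : Fin P × Fin M => μU) with hPr
  let Z : Fin P × Fin M → ((Fin P → ΩX) × (Fin P × Fin M → ΩU)) → ℝ :=
    fun k ω => S (ω.1 k.1, ω.2 k)
  have hmp : ∀ k : Fin P × Fin M, MeasurePreserving (fun w : (Fin P → ΩX) × (Fin P × Fin M → ΩU) =>
      (w.1 k.1, w.2 k)) Pr (μX.prod μU) := fun k => aux_mp_one μX μU k.1 k
  have hZ : ∀ k, MemLp (Z k) 2 Pr := fun k => hL.comp_measurePreserving (hmp k)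
  have hZi : ∀ k, ∫ ω, Z k ω ∂Pr = ∫ ω, S ω ∂(μX.prod μU) := by
    intro k
    rw [← (hmp k).map_eq, integral_map (hmp k).measurable.aemeasurable
      hS.aestronglyMeasurable]
  have hZv : ∀ k, Var[Z k; Pr] ≤ ∫ ω, S ω ^ 2 ∂(μX.prod μU) := by
    intro k
    have := (hmp k).variance_fun_comp (f := S) hS.aemeasurable
    rw [show Z k = fun w => S (w.1 k.1, w.2 k) from rfl, this]
    exact variance_le_expectation_sq hS.aestronglyMeasurable
  have hsum : (fun ω : (Fin P → ΩX) × (Fin P × Fin M → ΩU) =>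
      (1 / ((P : ℝ) * M)) * ∑ p : Fin P, ∑ i : Fin M, S (ω.1 p, ω.2 (p, i)))
      = fun ω => (1 / ((P : ℝ) * M)) * ∑ k, Z k ω := by
    funext ω
    rw [Fintype.sum_prod_type]
  have hcov : ∀ k l, cov[Z k, Z l; Pr] ≤
      if k.1 = l.1 then ∫ ω, S ω ^ 2 ∂(μX.prod μU) else 0 := by
    intro k l
    split_ifs with h
    · exact aux_cov_le Pr (hZ k) (hZ l) (hZv k) (hZv l)
    · have hkl : k ≠ l := fun e => h (by rw [e])
      have hi := (aux_indep μX μU h hkl).comp hS hS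
      exact (hi.covariance_eq_zero (hZ k) (hZ l)).le
  refine ⟨?_, ?_, ?_⟩
  · rw [hsum]
    exact (memLp_finsetSum _ fun k _ => hZ k).const_mul _
  · rw [hsum, integral_const_mul, integral_finsetSum _ fun k _ => (hZ k).integrable (by norm_num)]
    simp only [hZi, Finset.sum_const, Finset.card_univ, Fintype.card_prod, Fintype.card_fin,
      nsmul_eq_mul]
    push_cast
    field_simp
  · rw [hsum, variance_const_mul, variance_fun_sum hZ]
    set v := ∫ ω, S ω ^ 2 ∂(μX.prod μU)
    have h : ∑ k, ∑ l, cov[Z k, Z l; Pr] ≤ P * M * (M * v) := by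
      refine (Finset.sum_le_sum fun k _ => Finset.sum_le_sum fun l _ => hcov k l).trans ?_
      simp only [Fintype.sum_prod_type]
      have e : ∀ x : Fin P, ∑ y : Fin P, ∑ _z : Fin M, (if x = y then v else 0) = M * v := by
        intro x
        simp
      refine (Finset.sum_le_sum fun x _ => Finset.sum_le_sum fun y _ => (e x).le).trans ?_
      simp only [Finset.sum_const, Finset.card_univ, Fintype.card_fin, nsmul_eq_mul]
      apply le_of_eq; ring
    refine (mul_le_mul_of_nonneg_left h (by positivity)).trans (le_of_eq ?_)
    field_simp

lemma aux_compl {Ω : Type*} [MeasurableSpace Ω] (μ : Measure Ω) [IsProbabilityMeasure μ]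
    {s t : Set Ω} (hst : sᶜ ⊆ t) {δ : ℝ} (hδ : 0 ≤ δ) (ht : μ t ≤ ENNReal.ofReal δ) :
    1 - δ ≤ (μ s).toReal := by
  have h1 : (1 : ENNReal) ≤ μ s + μ t := by
    rw [← measure_univ (μ := μ), ← Set.union_compl_self s]
    exact (measure_union_le _ _).trans (by gcongr)
  have h2 : (1 : ENNReal) ≤ μ s + ENNReal.ofReal δ := h1.trans (by gcongr)
  have h3 := ENNReal.toReal_mono (by finiteness) h2
  rw [ENNReal.toReal_add (by finiteness) (by finiteness), ENNReal.toReal_ofReal hδ] at h3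
  simp at h3
  simp
  linarith

/-- Under hierarchical Monte Carlo sampling (i.i.d. prompts `ω.1 p ∼ μX`, conditionally
i.i.d. rollouts driven by `ω.2 (p,i) ∼ μU`) with `0 ≤ S_max ≤ H_max · N_max` a.s.
(`H_max = log |Z|`), the estimator `ĈE*_{max,P,M} = (PM)⁻¹ Σ_{p,i} S_max^{(p,i)}` is
unbiased for `CE*_max = E[S_max]`; for every `δ ∈ (0,1)`, with probability at least
`1 − δ`, `|ĈE* − CE*_max| ≤ H_max ν_max √((1/δ)(1/P + 1/(PM)))` with
`ν_max = √(E[N_max²])`; and consequently, with the truncation bias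
`g(T_max) = CE* − CE*_max ≥ 0`, with probability at least `1 − δ`,
`|ĈE* − CE*| ≤ H_max ν_max √((1/δ)(1/P + 1/(PM))) + g(T_max)`. -/
theorem unbiased_and_high_prob_bound_hierarchical_MC
    {Zalph ΩX ΩU : Type*} [Fintype Zalph] [Nonempty Zalph]
    [MeasurableSpace ΩX] [MeasurableSpace ΩU]
    (μX : Measure ΩX) (μU : Measure ΩU)
    [IsProbabilityMeasure μX] [IsProbabilityMeasure μU]
    (S₀ : ΩX × ΩU → ℝ) (N₀ : ΩX × ΩU → ℕ)
    (hSmeas : Measurable S₀) (hNmeas : Measurable N₀)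
    (hbound : ∀ᵐ ω ∂(μX.prod μU),
      0 ≤ S₀ ω ∧ S₀ ω ≤ Real.log (Fintype.card Zalph) * (N₀ ω : ℝ))
    (hN2 : Integrable (fun ω => ((N₀ ω : ℝ)) ^ 2) (μX.prod μU))
    (CEstar : ℝ)
    (hbias : 0 ≤ CEstar - ∫ ω, S₀ ω ∂(μX.prod μU))
    (P M : ℕ) (hP : 1 ≤ P) (hM : 1 ≤ M)
    (δ : ℝ) (hδ : δ ∈ Set.Ioo (0 : ℝ) 1) :
    (∫ ω, ((1 / ((P : ℝ) * M)) * ∑ p : Fin P, ∑ i : Fin M, S₀ (ω.1 p, ω.2 (p, i)))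
        ∂((Measure.pi fun _ : Fin P => μX).prod (Measure.pi fun _ : Fin P × Fin M => μU))
      = ∫ ω, S₀ ω ∂(μX.prod μU))
    ∧ (1 - δ ≤
        (((Measure.pi fun _ : Fin P => μX).prod (Measure.pi fun _ : Fin P × Fin M => μU))
          {ω : (Fin P → ΩX) × (Fin P × Fin M → ΩU) |
            |(1 / ((P : ℝ) * M)) * ∑ p : Fin P, ∑ i : Fin M, S₀ (ω.1 p, ω.2 (p, i))
                - ∫ ω', S₀ ω' ∂(μX.prod μU)|
              ≤ Real.log (Fintype.card Zalph)
                  * Real.sqrt (∫ ω', ((N₀ ω' : ℝ)) ^ 2 ∂(μX.prod μU))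
                  * Real.sqrt ((1 / δ) * (1 / (P : ℝ) + 1 / ((P : ℝ) * M)))}).toReal)
    ∧ (1 - δ ≤
        (((Measure.pi fun _ : Fin P => μX).prod (Measure.pi fun _ : Fin P × Fin M => μU))
          {ω : (Fin P → ΩX) × (Fin P × Fin M → ΩU) |
            |(1 / ((P : ℝ) * M)) * ∑ p : Fin P, ∑ i : Fin M, S₀ (ω.1 p, ω.2 (p, i))
                - CEstar|
              ≤ Real.log (Fintype.card Zalph)
                  * Real.sqrt (∫ ω', ((N₀ ω' : ℝ)) ^ 2 ∂(μX.prod μU))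
                  * Real.sqrt ((1 / δ) * (1 / (P : ℝ) + 1 / ((P : ℝ) * M)))
                + (CEstar - ∫ ω', S₀ ω' ∂(μX.prod μU))}).toReal) := by
  obtain ⟨hδ0, hδ1⟩ := hδ
  have hP' : (0 : ℝ) < P := by exact_mod_cast hP
  have hM' : (0 : ℝ) < M := by exact_mod_cast hM
  set H := Real.log (Fintype.card Zalph) with hH
  have hH0 : 0 ≤ H := Real.log_natCast_nonneg _
  have hdom : Integrable (fun ω => H ^ 2 * (N₀ ω : ℝ) ^ 2) (μX.prod μU) := hN2.const_mul _
  have hle : ∀ᵐ ω ∂(μX.prod μU), S₀ ω ^ 2 ≤ H ^ 2 * (N₀ ω : ℝ) ^ 2 := by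
    filter_upwards [hbound] with ω h
    rw [← mul_pow]
    exact pow_le_pow_left₀ h.1 h.2 2
  have hS2 : Integrable (fun ω => S₀ ω ^ 2) (μX.prod μU) := by
    refine hdom.mono' (hSmeas.pow_const 2).aestronglyMeasurable ?_
    filter_upwards [hle] with ω h
    rwa [Real.norm_of_nonneg (sq_nonneg _)]
  have hL : MemLp S₀ 2 (μX.prod μU) :=
    (memLp_two_iff_integrable_sq hSmeas.aestronglyMeasurable).2 hS2
  have hv : ∫ ω, S₀ ω ^ 2 ∂(μX.prod μU) ≤ H ^ 2 * ∫ ω, (N₀ ω : ℝ) ^ 2 ∂(μX.prod μU) := by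
    rw [← integral_const_mul]
    exact integral_mono_ae hS2 hdom hle
  have hn : 0 ≤ ∫ ω, (N₀ ω : ℝ) ^ 2 ∂(μX.prod μU) := integral_nonneg fun _ => sq_nonneg _
  obtain ⟨hF, hE, hV⟩ := aux_main μX μU S₀ hSmeas hL P M hP hM
  set Pr := (Measure.pi fun _ : Fin P => μX).prod (Measure.pi fun _ : Fin P × Fin M => μU) with hPr
  set m := ∫ ω, S₀ ω ∂(μX.prod μU) with hm
  set n2 := ∫ ω, (N₀ ω : ℝ) ^ 2 ∂(μX.prod μU) with hn2
  set c := H * Real.sqrt n2 * Real.sqrt ((1 / δ) * (1 / (P : ℝ) + 1 / ((P : ℝ) * M))) with hc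
  have hc0 : 0 ≤ c := by positivity
  have hc2 : c ^ 2 = H ^ 2 * n2 * ((1 / δ) * (1 / (P : ℝ) + 1 / ((P : ℝ) * M))) := by
    rw [hc, mul_pow, mul_pow, Real.sq_sqrt hn, Real.sq_sqrt (by positivity)]
  -- tail bound
  have htail : Pr {ω : (Fin P → ΩX) × (Fin P × Fin M → ΩU) |
      c < |(1 / ((P : ℝ) * M)) * ∑ p : Fin P, ∑ i : Fin M, S₀ (ω.1 p, ω.2 (p, i)) - m|}
      ≤ ENNReal.ofReal δ := by
    have hVc : ProbabilityTheory.variance (fun ω : (Fin P → ΩX) × (Fin P × Fin M → ΩU) =>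
      (1 / ((P : ℝ) * M)) * ∑ p : Fin P, ∑ i : Fin M, S₀ (ω.1 p, ω.2 (p, i))) Pr ≤ δ * c ^ 2 := by
      refine hV.trans ?_
      have e : δ * c ^ 2 = H ^ 2 * n2 / P + H ^ 2 * n2 / (P * M) := by
        rw [hc2]; field_simp
      rw [e]
      have : 0 ≤ H ^ 2 * n2 / (P * M) := by positivity
      have : (∫ ω, S₀ ω ^ 2 ∂(μX.prod μU)) / P ≤ H ^ 2 * n2 / P := by gcongr
      linarith
    rcases hc0.eq_or_lt with h0 | hpos
    · have hV0 : ProbabilityTheory.variance (fun ω : (Fin P → ΩX) × (Fin P × Fin M → ΩU) =>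
        (1 / ((P : ℝ) * M)) * ∑ p : Fin P, ∑ i : Fin M, S₀ (ω.1 p, ω.2 (p, i))) Pr = 0 := by
        refine le_antisymm (hVc.trans ?_) (ProbabilityTheory.variance_nonneg _ _)
        rw [← h0]; simp
      rw [ProbabilityTheory.variance_eq_integral hF.1.aemeasurable, hE] at hV0
      replace hV0 := (integral_eq_zero_iff_of_nonneg (fun _ => sq_nonneg _)
          ((hF.sub (memLp_const m)).integrable_sq)).1 hV0
      rw [measure_eq_zero_iff_ae_notMem.2]
      · exact zero_le
      · filter_upwards [hV0] with ω hω
        simp only [Pi.sub_apply, Pi.zero_apply, ne_eq, OfNat.ofNat_ne_zero, not_false_eq_true,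
          pow_eq_zero_iff] at hω
        rw [hω, ← h0]
        simp
    · have h := ProbabilityTheory.meas_ge_le_variance_div_sq hF hpos
      rw [hE] at h
      refine (measure_mono ?_).trans (h.trans (ENNReal.ofReal_le_ofReal ?_))
      · intro ω hω
        rw [Set.mem_ofPred_eq] at hω ⊢
        exact le_of_lt hω
      · rw [div_le_iff₀ (by positivity)]
        exact hVc
  refine ⟨hE, ?_, ?_⟩
  · refine aux_compl Pr ?_ hδ0.le htail
    intro ω hω
    simpa using hω
  · refine aux_compl Pr ?_ hδ0.le htail
    intro ω hω
    simp only [Set.mem_compl_iff, Set.mem_ofPred_eq, not_le] at hω ⊢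
    set F := (1 / ((P : ℝ) * M)) * ∑ p : Fin P, ∑ i : Fin M, S₀ (ω.1 p, ω.2 (p, i))
    have h1 : |F - CEstar| ≤ |F - m| + |m - CEstar| := abs_sub_le _ _ _
    rw [abs_sub_comm m, abs_of_nonneg hbias] at h1
    linarith
end
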